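/- With αβ = π̃² and fixed compatible square roots, the double series over monic polynomials satisfies the symmetry: ∑_{B ∈ R₁} ∑_{A ∈ R₁} 1/((π̃A)^{(q−1)j}((αB)^{q−1} − (π̃A)^{q−1})) = −(β/α)^{((q−1)/2)(j+1)} ∑_{A ∈ R₁} ∑_{B ∈ R₁} 1/((βA)^{(q−1)j}((βA)^{q−1} − (π̃B)^{q−1})). -/

import Mathlib

open Polynomial Filter Topology

section TsumComm

variable {K X Y : Type*} [NormedRing K] [CompleteSpace K]

open Classical in
/-- If `S` meets every row in at most one point and the family is summable off `S`, then the
iterated sum converges if and only if the sum over `S` does, and is then the sum of the two parts. -/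
theorem tsum_tsum_eq_of_injOn_fst (g : X × Y → K) (S : Set (X × Y))
    (hS : Set.InjOn Prod.fst S) (hg : Summable (Sᶜ.indicator g)) :
    ∑' x, ∑' y, g (x, y) =
      if Summable (fun s : S => g s) then
        ∑' s : S, g s + ∑' z, Sᶜ.indicator g z else 0 := by
  have hinj : Function.Injective (fun s : S => s.1.1) := fun s t h => Subtype.ext (hS s.2 t.2 h)
  set r : X → K := fun x => ∑' y, S.indicator g (x, y) with hr
  have hval : ∀ s : S, r s.1.1 = g s.1 := by
    rintro ⟨⟨x, y⟩, hs⟩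
    have : r x = S.indicator g (x, y) := by
      refine tsum_eq_single y fun y' hy' => Set.indicator_of_notMem (fun h => hy' ?_) _
      exact (Prod.ext_iff.1 (hS h hs rfl)).2
    simpa [Set.indicator_of_mem hs] using this
  have hzero : ∀ x ∉ Set.range (fun s : S => s.1.1), r x = 0 := by
    intro x hx
    have : ∀ y, S.indicator g (x, y) = 0 := fun y =>
      Set.indicator_of_notMem (fun h => hx ⟨⟨(x, y), h⟩, rfl⟩) _
    simp [hr, this]
  have hcomp : r ∘ (fun s : S => s.1.1) = fun s : S => g s := funext hval
  have hrow : ∀ x, Summable fun y => S.indicator g (x, y) := by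
    intro x
    refine summable_of_hasFiniteSupport (Set.Subsingleton.finite ?_)
    intro y hy y' hy'
    exact (Prod.ext_iff.1 (hS (Set.mem_of_indicator_ne_zero hy)
      (Set.mem_of_indicator_ne_zero hy') rfl)).2
  have hsplit : ∀ x, ∑' y, g (x, y) = r x + ∑' y, Sᶜ.indicator g (x, y) := by
    intro x
    rw [hr, ← (hrow x).tsum_add (hg.prod_factor x)]
    refine tsum_congr fun y => ?_
    exact (congrFun (Set.indicator_self_add_compl S g) (x, y)).symm
  have hsum : Summable r ↔ Summable fun s : S => g s := by
    rw [← hinj.summable_iff hzero, hcomp]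
  have htsum : ∑' x, r x = ∑' s : S, g s := by
    rw [← hinj.tsum_eq (f := r), ← hcomp]
    · rfl
    · intro x hx
      by_contra h
      exact hx (hzero x h)
  simp_rw [hsplit]
  split_ifs with h
  · rw [(hsum.2 h).tsum_add hg.prod, htsum, hg.tsum_prod]
  · refine tsum_eq_zero_of_not_summable fun h' => h (hsum.1 ?_)
    simpa using h'.sub hg.prod

/-- Iterated sums may be exchanged, without assuming convergence, as soon as the family becomes
summable after removing a partial matching. -/
theorem tsum_tsum_comm_of_matching (g : X → Y → K) (S : Set (X × Y))
    (h₁ : Set.InjOn Prod.fst S) (h₂ : Set.InjOn Prod.snd S)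
    (hg : Summable (Sᶜ.indicator fun z : X × Y => g z.1 z.2)) :
    ∑' y, ∑' x, g x y = ∑' x, ∑' y, g x y := by
  classical
  let e := Equiv.prodComm Y X
  have hind : (e ⁻¹' S)ᶜ.indicator (fun z : Y × X => g z.2 z.1) =
      (Sᶜ.indicator fun z : X × Y => g z.1 z.2) ∘ e := by
    ext z
    simp [Set.indicator, e]
  have A := tsum_tsum_eq_of_injOn_fst (fun z : X × Y => g z.1 z.2) S h₁ hg
  have B := tsum_tsum_eq_of_injOn_fst (fun z : Y × X => g z.2 z.1) (e ⁻¹' S)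
    (fun s hs t ht h => e.injective (h₂ hs ht h)) (by rw [hind]; exact e.summable_iff.2 hg)
  let e' : (e ⁻¹' S) ≃ S := e.subtypeEquiv fun _ => Iff.rfl
  have h3 : (fun s : (e ⁻¹' S) => g s.1.2 s.1.1) = (fun s : S => g s.1.1 s.1.2) ∘ e' := rfl
  rw [hind, h3, e'.summable_iff,
    show tsum ((fun s : S => g s.1.1 s.1.2) ∘ e') = ∑' s : S, g s.1.1 s.1.2 from
      e'.tsum_eq (fun s : S => g s.1.1 s.1.2)] at B
  have h4 := e.tsum_eq (Sᶜ.indicator fun z : X × Y => g z.1 z.2)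
  simp only [Function.comp_def] at B
  rw [h4] at B
  exact B.trans A.symm

end TsumComm

theorem tsum_eq_zero_of_le_norm {K X : Type*} [NormedAddCommGroup K] [Infinite X] {f : X → K}
    {δ : ℝ} (hδ : 0 < δ) (hf : ∀ x, δ ≤ ‖f x‖) : ∑' x, f x = 0 := by
  refine tsum_eq_zero_of_not_summable fun h => ?_
  have := h.tendsto_cofinite_zero.norm
  rw [norm_zero] at this
  obtain ⟨x, hx⟩ := (this.eventually_lt_const hδ).exists
  exact absurd hx (hf x).not_gt

instance Polynomial.infinite_monic {R : Type*} [Semiring R] [Nontrivial R] :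
    Infinite {A : R[X] // A.Monic} :=
  Infinite.of_injective (fun n : ℕ => ⟨X ^ n, monic_X_pow n⟩) fun m n h => by
    simpa using congrArg (fun A : {A : R[X] // A.Monic} => A.1.natDegree) h

section Norm

variable {K : Type*} [NormedField K] {F : Type*} [Field F] [Fintype F] (ι : F[X] →+* K)

theorem norm_map_C_of_ne_zero {c : F} (hc : c ≠ 0) : ‖ι (C c)‖ = 1 := by
  have h1 : ‖ι (C c)‖ ^ (Fintype.card F - 1) = 1 := by
    rw [← norm_pow, ← map_pow, ← map_pow, FiniteField.pow_card_sub_one_eq_one c hc]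
    simp
  have h2 := Fintype.one_lt_card (α := F)
  exact (pow_eq_one_iff_of_nonneg (norm_nonneg _) (by omega)).1 h1

theorem norm_map_C_le_one (c : F) : ‖ι (C c)‖ ≤ 1 := by
  rcases eq_or_ne c 0 with rfl | hc
  · simp
  · exact (norm_map_C_of_ne_zero ι hc).le

theorem isUltrametricDist_of_polynomial_ringHom {K : Type*} [NormedField K] {F : Type*} [Field F]
    [Fintype F] (ι : F[X] →+* K) : IsUltrametricDist K := by
  refine IsUltrametricDist.isUltrametricDist_of_forall_norm_natCast_le_one fun n => ?_
  simpa using norm_map_C_le_one ι (n : F)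

theorem norm_map_le_one_of_norm_X_le_one (hX : ‖ι X‖ ≤ 1) (P : F[X]) : ‖ι P‖ ≤ 1 := by
  have := isUltrametricDist_of_polynomial_ringHom ι
  induction P using Polynomial.induction_on' with
  | add p q hp hq =>
    rw [map_add]
    exact (IsUltrametricDist.norm_add_le_max _ _).trans (max_le hp hq)
  | monomial n a =>
    rw [← C_mul_X_pow_eq_monomial, map_mul, map_pow, norm_mul, norm_pow]
    exact mul_le_one₀ (norm_map_C_le_one ι a) (by positivity)
      (pow_le_one₀ (norm_nonneg _) hX)

theorem norm_map_eq_pow_natDegree (hX : 1 < ‖ι X‖) {P : F[X]} (hP : P ≠ 0) :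
    ‖ι P‖ = ‖ι X‖ ^ P.natDegree := by
  have := isUltrametricDist_of_polynomial_ringHom ι
  by_cases hd : 0 < P.degree
  · clear hP
    refine degree_pos_induction_on (P := fun P => ‖ι P‖ = ‖ι X‖ ^ P.natDegree) P hd ?_ ?_ ?_
    · intro a h
      simp [norm_map_C_of_ne_zero ι h, natDegree_C_mul_X _ h]
    · intro p h ih
      rw [map_mul, norm_mul, ih, natDegree_mul_X (by rintro rfl; simp at h), pow_succ]
    · intro p a h ih
      have h1 : ‖ι (C a)‖ < ‖ι p‖ := by
        rw [ih]
        exact (norm_map_C_le_one ι a).trans_lt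
          (one_lt_pow₀ hX (natDegree_pos_iff_degree_pos.2 h).ne')
      rw [map_add, natDegree_add_C, ← ih,
        IsUltrametricDist.norm_add_eq_max_of_norm_ne_norm h1.ne', max_eq_left h1.le]
  · rw [eq_C_of_degree_le_zero (not_lt.1 hd)] at hP ⊢
    rw [norm_map_C_of_ne_zero ι (by simpa using hP), natDegree_C, pow_zero]

theorem one_le_norm_map (hX : 1 < ‖ι X‖) {P : F[X]} (hP : P ≠ 0) : 1 ≤ ‖ι P‖ := by
  rw [norm_map_eq_pow_natDegree ι hX hP]
  exact one_le_pow₀ hX.le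

theorem finite_setOf_monic_norm_map_le (hX : 1 < ‖ι X‖) (R : ℝ) :
    {A : {A : F[X] // A.Monic} | ‖ι A.1‖ ≤ R}.Finite := by
  obtain ⟨N, hN⟩ := pow_unbounded_of_one_lt R hX
  have : Finite (degreeLT F N) := Finite.of_equiv _ (degreeLTEquiv F N).toEquiv.symm
  refine Set.Finite.of_finite_image (f := Subtype.val)
    ((Set.toFinite (degreeLT F N : Set F[X])).subset ?_) Subtype.val_injective.injOn
  rintro _ ⟨A, hA, rfl⟩
  rw [SetLike.mem_coe, mem_degreeLT]
  have h0 := A.2.ne_zero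
  rw [← natDegree_lt_iff_degree_lt h0]
  rw [Set.mem_ofPred_eq, norm_map_eq_pow_natDegree ι hX h0] at hA
  exact (pow_lt_pow_iff_right₀ hX).1 (hA.trans_lt hN)

theorem pow_le_norm_pow_sub_pow {u v : K} {m : ℝ} (hm : 0 ≤ m)
    (h : ∀ c : F, c ≠ 0 → m ≤ ‖u - ι (C c) * v‖) :
    m ^ (Fintype.card F - 1) ≤ ‖u ^ (Fintype.card F - 1) - v ^ (Fintype.card F - 1)‖ := by
  classical
  obtain ⟨g, hg⟩ := IsCyclic.exists_generator (α := Fˣ)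
  have hord : orderOf g = Fintype.card F - 1 := by
    rw [orderOf_eq_card_of_forall_mem_zpowers hg, Nat.card_eq_fintype_card, Fintype.card_units]
  have hpos : 0 < Fintype.card F - 1 := Nat.sub_pos_of_lt Fintype.one_lt_card
  have hζ : IsPrimitiveRoot ((ι.comp C) (g : F)) (Fintype.card F - 1) := by
    refine IsPrimitiveRoot.map_of_injective (f := ι.comp C) ?_ (ι.comp C).injective
    rw [IsPrimitiveRoot.coe_units_iff, ← hord]
    exact IsPrimitiveRoot.orderOf g
  rw [hζ.pow_sub_pow_eq_prod_sub_mul _ _ hpos, norm_prod]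
  have hcard : ∏ _z ∈ nthRootsFinset (Fintype.card F - 1) (1 : K), m =
      m ^ (Fintype.card F - 1) := by
    rw [Finset.prod_const, hζ.card_nthRootsFinset]
  rw [← hcard]
  refine Finset.prod_le_prod (fun _ _ => hm) fun z hz => ?_
  have : NeZero (Fintype.card F - 1) := ⟨hpos.ne'⟩
  obtain ⟨i, -, rfl⟩ := hζ.eq_pow_of_pow_eq_one ((mem_nthRootsFinset hpos 1).1 hz)
  simpa using h ((g : F) ^ i) (by simp)

end Norm

section Series

variable {K : Type*} [NormedField K] {F : Type*} [Field F] [Fintype F] (ι : F[X] →+* K)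

/-- The pairs for which `βA` is close to a nonzero scalar multiple of `γB`. -/
def closePairs (β γ : K) : Set ({A : F[X] // A.Monic} × {A : F[X] // A.Monic}) :=
  {z | ∃ c : F, c ≠ 0 ∧ ‖β * ι z.1.1 - ι (C c) * (γ * ι z.2.1)‖ < min ‖β‖ ‖γ‖}

theorem eq_of_norm_map_C_mul_sub_lt_one (hX : 1 < ‖ι X‖) {A B : {A : F[X] // A.Monic}} {c d : F}
    (hc : c ≠ 0) (h : ‖ι (C c * A.1 - C d * B.1)‖ < 1) : A = B := by
  have h0 : C c * A.1 - C d * B.1 = 0 := by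
    by_contra h0
    exact h.not_ge (one_le_norm_map ι hX h0)
  have h1 := sub_eq_zero.1 h0
  have h2 := congrArg leadingCoeff h1
  simp only [leadingCoeff_mul, leadingCoeff_C, A.2.leadingCoeff, B.2.leadingCoeff, mul_one] at h2
  subst h2
  exact Subtype.ext (mul_left_cancel₀ (C_ne_zero.2 hc) h1)

theorem injOn_fst_closePairs (hX : 1 < ‖ι X‖) {β γ : K} (hγ : γ ≠ 0) :
    Set.InjOn Prod.fst (closePairs ι β γ) := by
  have := isUltrametricDist_of_polynomial_ringHom ι
  rintro ⟨A, B⟩ ⟨c, hc, h⟩ ⟨_, B'⟩ ⟨d, hd, h'⟩ rfl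
  have key : ‖γ‖ * ‖ι (C c * B.1 - C d * B'.1)‖ < ‖γ‖ := by
    rw [← norm_mul]
    have e : γ * ι (C c * B.1 - C d * B'.1) = (β * ι A.1 - ι (C d) * (γ * ι B'.1)) -
        (β * ι A.1 - ι (C c) * (γ * ι B.1)) := by
      simp only [map_sub, map_mul]
      ring
    rw [e, sub_eq_add_neg]
    exact (IsUltrametricDist.norm_add_le_max _ _).trans_lt (max_lt (h'.trans_le (min_le_right _ _))
      (by rw [norm_neg]; exact h.trans_le (min_le_right _ _)))
  have := eq_of_norm_map_C_mul_sub_lt_one ι hX hc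
    ((mul_lt_iff_lt_one_right (norm_pos_iff.2 hγ)).1 key)
  rw [this]

theorem preimage_swap_closePairs (β γ : K) :
    Prod.swap ⁻¹' closePairs ι β γ = closePairs ι γ β := by
  have key : ∀ (c : F) (x y : K), c ≠ 0 →
      ‖x - ι (C c⁻¹) * y‖ = ‖y - ι (C c) * x‖ := by
    intro c x y hc
    have e : y - ι (C c) * x = -(ι (C c) * (x - ι (C c⁻¹) * y)) := by
      have : ι (C c) * ι (C c⁻¹) = 1 := by
        rw [← map_mul, ← C_mul, mul_inv_cancel₀ hc]
        simp
      linear_combination (-y) * this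
    rw [e, norm_neg, norm_mul, norm_map_C_of_ne_zero ι hc, one_mul]
  ext ⟨A, B⟩
  constructor
  · rintro ⟨c, hc, h⟩
    refine ⟨c⁻¹, inv_ne_zero hc, ?_⟩
    rw [key c _ _ hc, min_comm]
    exact h
  · rintro ⟨c, hc, h⟩
    refine ⟨c⁻¹, inv_ne_zero hc, ?_⟩
    change ‖β * ι B.1 - ι (C c⁻¹) * (γ * ι A.1)‖ < _
    rw [key c _ _ hc, min_comm]
    exact h

theorem injOn_snd_closePairs (hX : 1 < ‖ι X‖) {β γ : K} (hβ : β ≠ 0) :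
    Set.InjOn Prod.snd (closePairs ι β γ) := by
  intro s hs t ht h
  rw [← preimage_swap_closePairs] at hs ht
  exact Prod.swap_injective (injOn_fst_closePairs ι hX hβ hs ht h)

theorem tendsto_max_norm_cofinite (hX : 1 < ‖ι X‖) {β γ : K} (hβ : β ≠ 0) (hγ : γ ≠ 0) :
    Tendsto (fun z : {A : F[X] // A.Monic} × {A : F[X] // A.Monic} =>
      max ‖β * ι z.1.1‖ ‖γ * ι z.2.1‖) cofinite atTop := by
  refine tendsto_atTop.2 fun R => ?_
  refine ((finite_setOf_monic_norm_map_le ι hX (R / ‖β‖)).prod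
    (finite_setOf_monic_norm_map_le ι hX (R / ‖γ‖))).subset ?_
  intro z hz
  have hz' : max ‖β * ι z.1.1‖ ‖γ * ι z.2.1‖ < R := not_le.1 hz
  rw [max_lt_iff, norm_mul, norm_mul] at hz'
  constructor
  · exact (le_div_iff₀' (norm_pos_iff.2 hβ)).2 hz'.1.le
  · exact (le_div_iff₀' (norm_pos_iff.2 hγ)).2 hz'.2.le

theorem summable_indicator_compl_closePairs [CompleteSpace K] (hX : 1 < ‖ι X‖) {β γ : K}
    (hβ : β ≠ 0) (hγ : γ ≠ 0) {j : ℕ} (hj : j ≠ 0) :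
    Summable ((closePairs ι β γ)ᶜ.indicator
      fun z => ((β * ι z.1.1) ^ ((Fintype.card F - 1) * j) *
        ((β * ι z.1.1) ^ (Fintype.card F - 1) - (γ * ι z.2.1) ^ (Fintype.card F - 1)))⁻¹) := by
  have := isUltrametricDist_of_polynomial_ringHom ι
  have hn : Fintype.card F - 1 ≠ 0 := (Nat.sub_pos_of_lt Fintype.one_lt_card).ne'
  set m : ℝ := min ‖β‖ ‖γ‖ with hm
  have hm0 : 0 < m := lt_min (norm_pos_iff.2 hβ) (norm_pos_iff.2 hγ)
  have hβ0 : 0 < ‖β‖ := norm_pos_iff.2 hβ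
  refine NonarchimedeanAddGroup.summable_of_tendsto_cofinite_zero ?_
  have hM := tendsto_max_norm_cofinite ι hX hβ hγ
  have hlim : Tendsto (fun M : ℝ => (‖β‖ ^ ((Fintype.card F - 1) * j))⁻¹ *
      (M ^ (Fintype.card F - 1))⁻¹ + (M ^ ((Fintype.card F - 1) * j))⁻¹ *
        (m ^ (Fintype.card F - 1))⁻¹) atTop (𝓝 0) := by
    have h1 := (tendsto_pow_atTop (α := ℝ) hn).inv_tendsto_atTop
    have h2 := (tendsto_pow_atTop (α := ℝ) (mul_ne_zero hn hj)).inv_tendsto_atTop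
    simpa using (h1.const_mul (‖β‖ ^ ((Fintype.card F - 1) * j))⁻¹).add
      (h2.mul_const (m ^ (Fintype.card F - 1))⁻¹)
  refine squeeze_zero_norm (fun z => ?_) (hlim.comp hM)
  by_cases hz : z ∈ closePairs ι β γ
  · rw [Set.indicator_of_notMem (by simpa using hz), norm_zero]
    simp only [Function.comp_apply]
    positivity
  rw [Set.indicator_of_mem hz, norm_inv, norm_mul, mul_inv, norm_pow]
  simp only [Function.comp_apply]
  have hz' : ∀ c : F, c ≠ 0 → m ≤ ‖β * ι z.1.1 - ι (C c) * (γ * ι z.2.1)‖ := by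
    intro c hc
    by_contra! h
    exact hz ⟨c, hc, h⟩
  have hu : ‖β‖ ≤ ‖β * ι z.1.1‖ := by
    rw [norm_mul]
    exact le_mul_of_one_le_right (norm_nonneg _) (one_le_norm_map ι hX z.1.2.ne_zero)
  have hlow := pow_le_norm_pow_sub_pow ι hm0.le hz'
  generalize β * ι z.1.1 = u at *
  generalize γ * ι z.2.1 = v at *
  have hu0 : 0 < ‖u‖ := hβ0.trans_le hu
  have hM0 : 0 < max ‖u‖ ‖v‖ := lt_max_of_lt_left hu0
  by_cases huv : ‖u‖ = ‖v‖
  · refine le_trans ?_ (le_add_of_nonneg_left (by positivity))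
    rw [← huv, max_self]
    gcongr
  · refine le_trans ?_ (le_add_of_nonneg_right (by positivity))
    have hne : ‖u ^ (Fintype.card F - 1)‖ ≠ ‖-v ^ (Fintype.card F - 1)‖ := by
      rw [norm_neg, norm_pow, norm_pow]
      exact fun h => huv ((pow_left_inj₀ (norm_nonneg _) (norm_nonneg _) hn).1 h)
    rw [sub_eq_add_neg, IsUltrametricDist.norm_add_eq_max_of_norm_ne_norm hne, norm_neg, norm_pow,
      norm_pow, ← (pow_left_monotoneOn (n := Fintype.card F - 1)).map_max (norm_nonneg u)
        (norm_nonneg v)]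
    gcongr

theorem tsum_tsum_comm_monic [CompleteSpace K] {β γ : K} (hβ : β ≠ 0) (hγ : γ ≠ 0)
    {j : ℕ} (hj : j ≠ 0)
    (hden : ∀ A B : {A : F[X] // A.Monic},
      (β * ι A.1) ^ (Fintype.card F - 1) - (γ * ι B.1) ^ (Fintype.card F - 1) ≠ 0)
    (hι : Function.Injective ι) :
    ∑' B : {A : F[X] // A.Monic}, ∑' A : {A : F[X] // A.Monic},
      ((β * ι A.1) ^ ((Fintype.card F - 1) * j) *
        ((β * ι A.1) ^ (Fintype.card F - 1) - (γ * ι B.1) ^ (Fintype.card F - 1)))⁻¹ =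
    ∑' A : {A : F[X] // A.Monic}, ∑' B : {A : F[X] // A.Monic},
      ((β * ι A.1) ^ ((Fintype.card F - 1) * j) *
        ((β * ι A.1) ^ (Fintype.card F - 1) - (γ * ι B.1) ^ (Fintype.card F - 1)))⁻¹ := by
  rcases lt_or_ge 1 ‖ι X‖ with hX | hX
  · exact tsum_tsum_comm_of_matching _ (closePairs ι β γ) (injOn_fst_closePairs ι hX hγ)
      (injOn_snd_closePairs ι hX hβ) (summable_indicator_compl_closePairs ι hX hβ hγ hj)
  set M : ℝ := ‖β‖ ^ ((Fintype.card F - 1) * j) *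
    (‖β‖ ^ (Fintype.card F - 1) + ‖γ‖ ^ (Fintype.card F - 1)) with hM
  have hβ0 : 0 < ‖β‖ := norm_pos_iff.2 hβ
  have hγ0 : 0 < ‖γ‖ := norm_pos_iff.2 hγ
  have hM0 : 0 < M := by positivity
  have hbound : ∀ A B : {A : F[X] // A.Monic}, M⁻¹ ≤
      ‖((β * ι A.1) ^ ((Fintype.card F - 1) * j) *
        ((β * ι A.1) ^ (Fintype.card F - 1) - (γ * ι B.1) ^ (Fintype.card F - 1)))⁻¹‖ := by
    intro A B
    have hA : ‖β * ι A.1‖ ≤ ‖β‖ := by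
      rw [norm_mul]
      exact mul_le_of_le_one_right hβ0.le (norm_map_le_one_of_norm_X_le_one ι hX _)
    have hB : ‖γ * ι B.1‖ ≤ ‖γ‖ := by
      rw [norm_mul]
      exact mul_le_of_le_one_right hγ0.le (norm_map_le_one_of_norm_X_le_one ι hX _)
    have hA0 : ι A.1 ≠ 0 := (map_ne_zero_iff ι hι).2 A.2.ne_zero
    rw [norm_inv]
    refine inv_anti₀ (norm_pos_iff.2 (mul_ne_zero (pow_ne_zero _ (mul_ne_zero hβ hA0))
      (hden A B))) ?_
    rw [norm_mul, norm_pow, hM]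
    gcongr
    refine (norm_sub_le _ _).trans ?_
    rw [norm_pow, norm_pow]
    gcongr
  have h1 : ∀ B : {A : F[X] // A.Monic}, ∑' A : {A : F[X] // A.Monic},
      ((β * ι A.1) ^ ((Fintype.card F - 1) * j) *
        ((β * ι A.1) ^ (Fintype.card F - 1) - (γ * ι B.1) ^ (Fintype.card F - 1)))⁻¹ = 0 :=
    fun B => tsum_eq_zero_of_le_norm (inv_pos.2 hM0) fun A => hbound A B
  have h2 : ∀ A : {A : F[X] // A.Monic}, ∑' B : {A : F[X] // A.Monic},
      ((β * ι A.1) ^ ((Fintype.card F - 1) * j) *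
        ((β * ι A.1) ^ (Fintype.card F - 1) - (γ * ι B.1) ^ (Fintype.card F - 1)))⁻¹ = 0 :=
    fun A => tsum_eq_zero_of_le_norm (inv_pos.2 hM0) fun B => hbound A B
  simp_rw [h1, h2]

end Series

/-- With `αβ = π̃²`, the double series over monic polynomials satisfies the symmetry
`∑_B ∑_A 1/((π̃A)^{(q-1)j}((αB)^{q-1} - (π̃A)^{q-1}))
  = -(β/α)^{((q-1)/2)(j+1)} ∑_A ∑_B 1/((βA)^{(q-1)j}((βA)^{q-1} - (π̃B)^{q-1}))`. -/
theorem double_series_symmetry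
    (p n q : ℕ) (hp : p.Prime) (hp2 : p ≠ 2) (hn : 0 < n) (hq : q = p ^ n)
    {K : Type*} [NontriviallyNormedField K] [CompleteSpace K]
    {Fq : Type*} [Field Fq] [Fintype Fq] (hcard : Fintype.card Fq = q)
    (ι : Polynomial Fq →+* K) (hι : Function.Injective ι)
    (π' : K) (hπ : π' ≠ 0)
    (α β : K) (hα : α ≠ 0) (hβ : β ≠ 0) (hαβ : α * β = π' ^ 2)
    (hden : ∀ A B : {A : Polynomial Fq // A.Monic},
      (α * ι B.1) ^ (q - 1) - (π' * ι A.1) ^ (q - 1) ≠ 0)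
    (hden' : ∀ A B : {A : Polynomial Fq // A.Monic},
      (β * ι A.1) ^ (q - 1) - (π' * ι B.1) ^ (q - 1) ≠ 0)
    (j : ℕ) (hj : 1 ≤ j) :
    (∑' B : {A : Polynomial Fq // A.Monic}, ∑' A : {A : Polynomial Fq // A.Monic},
        ((π' * ι A.1) ^ ((q - 1) * j) *
          ((α * ι B.1) ^ (q - 1) - (π' * ι A.1) ^ (q - 1)))⁻¹) =
    -((β / α) ^ (((q - 1) / 2) * (j + 1))) *
      ∑' A : {A : Polynomial Fq // A.Monic}, ∑' B : {A : Polynomial Fq // A.Monic},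
        ((β * ι A.1) ^ ((q - 1) * j) *
          ((β * ι A.1) ^ (q - 1) - (π' * ι B.1) ^ (q - 1)))⁻¹ := by
  subst hcard
  have hcomm := tsum_tsum_comm_monic ι hβ hπ (Nat.one_le_iff_ne_zero.1 hj) hden' hι
  rw [← hcomm, ← tsum_mul_left]
  refine tsum_congr fun B => ?_
  rw [← tsum_mul_left]
  refine tsum_congr fun A => ?_
  have hodd : Odd (Fintype.card Fq) := by
    rw [hq]
    exact (hp.odd_of_ne_two hp2).pow
  obtain ⟨k, hk⟩ := hodd
  have hk1 : Fintype.card Fq - 1 = 2 * k := by omega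
  have hd := hden' A B
  rw [hk1] at hd ⊢
  have hα' : α = π' ^ 2 / β := by
    rw [← hαβ]
    field_simp
  have hA0 : ι A.1 ≠ 0 := (map_ne_zero_iff ι hι).2 A.2.ne_zero
  have e1 : β / α = (β / π') ^ 2 := by
    rw [hα']
    field_simp
  have e2 : π' * ι A.1 = (π' / β) * (β * ι A.1) := by
    field_simp
  have e3 : α * ι B.1 = (π' / β) * (π' * ι B.1) := by
    rw [hα']
    field_simp
  rw [e1, e3, e2, Nat.mul_div_cancel_left k two_pos, ← pow_mul]
  have e4 : β / π' = (π' / β)⁻¹ := (inv_div _ _).symm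
  rw [e4]
  generalize π' / β = t
  generalize β * ι A.1 = u at *
  generalize π' * ι B.1 = v at *
  rw [inv_pow, ← inv_neg, ← mul_inv]
  congr 1
  ring
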